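/- arXiv:2605.00301 — 2 statements merged into one kernel-verified Lean document; each statement's English description precedes it below -/
import Mathlib

section
/- For every prime $p$, one has $\log p \cdot \sum_{q \geq 2} \frac{\Lambda(q)}{q \log^2(pq)} + \sum_{k \geq 2} \frac{1}{k^2 p^{k-1}} \leq 1$, where the first sum is over natural numbers $q \geq 2$ and the second over integers $k \geq 2$. (This is the sub-invariance inequality for the doubly harmonic weight at a prime state of the modified von Mangoldt downward chain.) -/
/-- A real Dirichlet series at a real point, seen as a complex L-series. -/
lemma lseriesHasSum_ofReal_iff {f : ℕ → ℝ} {s a : ℝ} (hs : s ≠ 0) :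
    LSeriesHasSum (fun n ↦ (f n : ℂ)) s a ↔ HasSum (fun n : ℕ ↦ f n / (n : ℝ) ^ s) a := by
  rw [LSeriesHasSum, ← Complex.hasSum_ofReal]
  refine iff_of_eq (congrArg (HasSum · (a : ℂ)) (funext fun n ↦ ?_))
  rw [LSeries.term_of_ne_zero' (by exact_mod_cast hs)]
  push_cast [Complex.ofReal_cpow n.cast_nonneg]
  rfl

lemma summable_vonMangoldt_div_rpow {s : ℝ} (hs : 1 < s) :
    Summable fun n : ℕ ↦ ArithmeticFunction.vonMangoldt n / (n : ℝ) ^ s := by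
  have h := ArithmeticFunction.LSeriesSummable_vonMangoldt (s := s) (by simpa using hs)
  rw [← Complex.summable_ofReal]
  refine h.congr fun n ↦ ?_
  rw [LSeries.term_of_ne_zero' (by exact_mod_cast (by linarith : s ≠ 0))]
  push_cast [Complex.ofReal_cpow n.cast_nonneg]
  rfl

lemma hasSum_log_div_rpow {s : ℝ} (hs : 1 < s) :
    HasSum (fun n : ℕ ↦ Real.log n / (n : ℝ) ^ s)
      ((∑' n : ℕ, ArithmeticFunction.vonMangoldt n / (n : ℝ) ^ s) *
        ∑' n : ℕ, 1 / (n : ℝ) ^ s) := by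
  have hs0 : s ≠ 0 := by linarith
  have hΛ := (lseriesHasSum_ofReal_iff hs0).2 (summable_vonMangoldt_div_rpow hs).hasSum
  have hone := (lseriesHasSum_ofReal_iff (f := fun _ ↦ 1) hs0).2
    (Real.summable_one_div_nat_rpow.2 hs).hasSum
  have h := hΛ.convolution hone
  rw [← Complex.ofReal_mul] at h
  refine (lseriesHasSum_ofReal_iff hs0).1 ?_
  convert! h using 1
  ext n
  have := congrFun ArithmeticFunction.convolution_vonMangoldt_const_one n
  simp only [Complex.ofReal_one]
  rw [← Complex.natCast_log] at this
  exact this.symm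

/-- Partial sum `log 2 / 2 ^ s - log 3 / 3 ^ s + log 4 / 4 ^ s - log 5 / 5 ^ s` of the derivative
of the Dirichlet eta function. -/
lemma log_three_add_log_five_div_rpow_le {s : ℝ} (hs : 1 ≤ s) :
    Real.log 3 / 3 ^ s + Real.log 5 / 5 ^ s ≤ Real.log 2 / 2 ^ s + Real.log 4 / 4 ^ s := by
  have h4 : Real.log 4 = 2 * Real.log 2 := by
    rw [show (4 : ℝ) = 2 ^ 2 by norm_num, Real.log_pow]; norm_num
  have hl2 : 0 < Real.log 2 := Real.log_pos (by norm_num)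
  have hl5 : 0 < Real.log 5 := Real.log_pos (by norm_num)
  have hlog : 5 * Real.log 3 + 3 * Real.log 5 ≤ 15 * Real.log 2 := by
    have h : Real.log (3 ^ 5 * 5 ^ 3) ≤ Real.log (2 ^ 15) :=
      Real.log_le_log (by norm_num) (by norm_num)
    rw [Real.log_mul (by norm_num) (by norm_num), Real.log_pow, Real.log_pow, Real.log_pow] at h
    norm_num at h
    exact h
  obtain ⟨u, hu, rfl⟩ : ∃ u : ℝ, 0 ≤ u ∧ s = 1 + u := ⟨s - 1, by linarith, by ring⟩
  have hx : 1 ≤ (3 / 2 : ℝ) ^ u * (3 / 4 : ℝ) ^ u := by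
    rw [← Real.mul_rpow (by norm_num) (by norm_num)]
    exact Real.one_le_rpow (by norm_num) hu
  have hz : (3 / 5 : ℝ) ^ u ≤ 1 := Real.rpow_le_one (by norm_num) (by norm_num) hu
  have hpx : 0 < (3 / 2 : ℝ) ^ u := by positivity
  have hpy : 0 < (3 / 4 : ℝ) ^ u := by positivity
  rw [Real.div_rpow (by norm_num) (by norm_num)] at hx hz hpx hpy
  rw [Real.div_rpow (by norm_num) (by norm_num)] at hx
  have hp3 : 0 < (3 : ℝ) ^ u := by positivity
  have hp2 : 0 < (2 : ℝ) ^ u := by positivity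
  have hp4 : 0 < (4 : ℝ) ^ u := by positivity
  have hp5 : 0 < (5 : ℝ) ^ u := by positivity
  have hxy : 2 ≤ (3 : ℝ) ^ u / 2 ^ u + 3 ^ u / 4 ^ u := by
    nlinarith [sq_nonneg ((3 : ℝ) ^ u / 2 ^ u - 3 ^ u / 4 ^ u)]
  have key : Real.log 3 + 3 / 5 * Real.log 5 * ((3 : ℝ) ^ u / 5 ^ u) ≤
      3 / 2 * Real.log 2 * ((3 : ℝ) ^ u / 2 ^ u + 3 ^ u / 4 ^ u) := by
    nlinarith [mul_le_mul_of_nonneg_left hz hl5.le, mul_le_mul_of_nonneg_left hxy hl2.le]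
  simp only [Real.rpow_add (by norm_num : (0 : ℝ) < 3), Real.rpow_add (by norm_num : (0 : ℝ) < 2),
    Real.rpow_add (by norm_num : (0 : ℝ) < 4), Real.rpow_add (by norm_num : (0 : ℝ) < 5),
    Real.rpow_one, h4]
  calc _ = (Real.log 3 + 3 / 5 * Real.log 5 * ((3 : ℝ) ^ u / 5 ^ u)) / (3 * 3 ^ u) := by
        field_simp
    _ ≤ 3 / 2 * Real.log 2 * ((3 : ℝ) ^ u / 2 ^ u + 3 ^ u / 4 ^ u) / (3 * 3 ^ u) := by gcongr
    _ = _ := by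
        field_simp
        ring

lemma tsum_log_odd_le_tsum_log_even {s : ℝ} (hs : 1 < s) :
    ∑' k : ℕ, Real.log (2 * k + 1 : ℕ) / ((2 * k + 1 : ℕ) : ℝ) ^ s ≤
      ∑' k : ℕ, Real.log (2 * k : ℕ) / ((2 * k : ℕ) : ℝ) ^ s := by
  have hsum := (hasSum_log_div_rpow hs).summable
  have he : Summable fun k : ℕ ↦ Real.log (2 * k : ℕ) / ((2 * k : ℕ) : ℝ) ^ s :=
    hsum.comp_injective (i := fun k : ℕ ↦ 2 * k) fun a b h ↦ by simpa using h
  have ho : Summable fun k : ℕ ↦ Real.log (2 * k + 1 : ℕ) / ((2 * k + 1 : ℕ) : ℝ) ^ s :=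
    hsum.comp_injective (i := fun k : ℕ ↦ 2 * k + 1) fun a b h ↦ by simpa using h
  rw [← sub_nonneg, ← he.tsum_sub ho]
  refine le_trans ?_ ((he.sub ho).sum_le_tsum (Finset.range 3) fun k hk ↦ ?_)
  · have := log_three_add_log_five_div_rpow_le hs.le
    simp [Finset.sum_range_succ]
    linarith
  · have hk3 : (3 : ℝ) ≤ k := by
      have : 3 ≤ k := by simpa using hk
      exact_mod_cast this
    have hexp : Real.exp s⁻¹ ≤ 3 :=
      (Real.exp_le_exp.2 (inv_le_one_of_one_le₀ hs.le)).trans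
        (Real.exp_one_lt_d9.le.trans (by norm_num))
    refine sub_nonneg.2 (Real.log_div_self_rpow_antitoneOn (by linarith)
      (Set.mem_Ici.2 ?_) (Set.mem_Ici.2 ?_) ?_) <;> push_cast <;> linarith

/-- The inequality `-ζ'(s) / ζ(s) ≤ log 2 / (2 ^ (s - 1) - 1)`, expressing that the Dirichlet eta
function is increasing. -/
lemma tsum_vonMangoldt_div_rpow_mul_le {u : ℝ} (hu : 0 < u) :
    (∑' n : ℕ, ArithmeticFunction.vonMangoldt n / (n : ℝ) ^ (1 + u)) * (2 ^ u - 1) ≤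
      Real.log 2 := by
  have hs : 1 < 1 + u := by linarith
  have hlog := hasSum_log_div_rpow hs
  have hone := Real.summable_one_div_nat_rpow.2 hs
  have hle := tsum_log_odd_le_tsum_log_even hs
  have hsplit := tsum_even_add_odd (f := fun n : ℕ ↦ Real.log n / (n : ℝ) ^ (1 + u))
    (hlog.summable.comp_injective (i := fun k : ℕ ↦ 2 * k) fun a b h ↦ by simpa using h)
    (hlog.summable.comp_injective (i := fun k : ℕ ↦ 2 * k + 1) fun a b h ↦ by simpa using h)
  have heven : ∑' k : ℕ, Real.log (2 * k : ℕ) / ((2 * k : ℕ) : ℝ) ^ (1 + u) =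
      (Real.log 2 * ∑' n : ℕ, 1 / (n : ℝ) ^ (1 + u) +
        ∑' n : ℕ, Real.log n / (n : ℝ) ^ (1 + u)) / (2 * 2 ^ u) := by
    rw [← tsum_mul_left, ← (hone.mul_left _).tsum_add hlog.summable, ← tsum_div_const]
    refine tsum_congr fun k ↦ ?_
    rcases eq_or_ne k 0 with rfl | hk
    · simp [Real.zero_rpow (by linarith : 1 + u ≠ 0)]
    · have hk' : (k : ℝ) ≠ 0 := by exact_mod_cast hk
      push_cast
      rw [Real.log_mul (by norm_num) hk', Real.mul_rpow (by norm_num) k.cast_nonneg,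
        Real.rpow_add (by norm_num : (0 : ℝ) < 2), Real.rpow_one]
      field_simp
  rw [hlog.tsum_eq] at heven hsplit
  set D := ∑' n : ℕ, ArithmeticFunction.vonMangoldt n / (n : ℝ) ^ (1 + u)
  have hZ : 0 < ∑' n : ℕ, 1 / (n : ℝ) ^ (1 + u) :=
    hone.tsum_pos (fun n ↦ by positivity) 1 (by simp)
  set Z := ∑' n : ℕ, 1 / (n : ℝ) ^ (1 + u)
  have h2 : (0 : ℝ) < 2 ^ u := by positivity
  have h : D * Z ≤ 2 * ((Real.log 2 * Z + D * Z) / (2 * 2 ^ u)) := by linarith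
  rw [show 2 * ((Real.log 2 * Z + D * Z) / (2 * 2 ^ u)) = (Real.log 2 * Z + D * Z) / 2 ^ u by
    field_simp, le_div_iff₀ h2] at h
  refine le_of_mul_le_mul_right ?_ hZ
  linarith

lemma mul_exp_half_le_exp_sub_one {x : ℝ} (hx : 0 ≤ x) :
    x * Real.exp (x / 2) ≤ Real.exp x - 1 := by
  have h := Real.self_le_sinh_iff.2 (by linarith : 0 ≤ x / 2)
  rw [Real.sinh_eq, Real.exp_neg] at h
  have hp := Real.exp_pos (x / 2)
  have hx2 : Real.exp x = Real.exp (x / 2) * Real.exp (x / 2) := by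
    rw [← Real.exp_add]; ring_nf
  have := mul_le_mul_of_nonneg_right h hp.le
  rw [div_mul_eq_mul_div, div_mul_eq_mul_div, sub_mul, inv_mul_cancel₀ hp.ne'] at this
  linarith

lemma mul_tsum_vonMangoldt_div_rpow_le {u : ℝ} (hu : 0 < u) :
    u * ∑' n : ℕ, ArithmeticFunction.vonMangoldt n / (n : ℝ) ^ (1 + u) ≤
      Real.exp (-(Real.log 2 / 2 * u)) := by
  have hl2 : 0 < Real.log 2 := Real.log_pos (by norm_num)
  have h1 := tsum_vonMangoldt_div_rpow_mul_le hu
  have hD : 0 ≤ ∑' n : ℕ, ArithmeticFunction.vonMangoldt n / (n : ℝ) ^ (1 + u) :=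
    tsum_nonneg fun n ↦ div_nonneg ArithmeticFunction.vonMangoldt_nonneg (by positivity)
  set D := ∑' n : ℕ, ArithmeticFunction.vonMangoldt n / (n : ℝ) ^ (1 + u)
  have h2 := mul_exp_half_le_exp_sub_one (mul_pos hl2 hu).le
  rw [← Real.rpow_def_of_pos (by norm_num)] at h2
  have h3 := (mul_le_mul_of_nonneg_left h2 hD).trans h1
  rw [Real.exp_neg, ← one_div, le_div_iff₀ (Real.exp_pos _)]
  refine le_of_mul_le_mul_left ?_ hl2
  rw [show Real.log 2 / 2 * u = Real.log 2 * u / 2 by ring]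
  linarith

lemma integrableOn_mul_exp_neg_mul {b : ℝ} (hb : 0 < b) :
    MeasureTheory.IntegrableOn (fun u ↦ u * Real.exp (-(b * u))) (Set.Ioi 0) := by
  simpa using integrableOn_rpow_mul_exp_neg_mul_rpow (s := 1) (p := 1) (by norm_num) one_pos hb

lemma integral_mul_exp_neg_mul {b : ℝ} (hb : 0 < b) :
    ∫ u in Set.Ioi (0 : ℝ), u * Real.exp (-(b * u)) = 1 / b ^ 2 := by
  have h := Real.integral_rpow_mul_exp_neg_mul_Ioi (a := 2) (by norm_num) hb
  rw [Real.Gamma_two, mul_one, Real.rpow_two, one_div_pow] at h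
  norm_num at h
  simpa using h

lemma sum_vonMangoldt_div_mul_sq_le {p : ℝ} (hp : 1 < p) (N : ℕ) :
    ∑ q ∈ Finset.range N, (if 2 ≤ q then
        ArithmeticFunction.vonMangoldt q / ((q : ℝ) * (Real.log (p * q)) ^ 2) else 0) ≤
      1 / (Real.log p + Real.log 2 / 2) := by
  have hl2 : 0 < Real.log 2 := Real.log_pos (by norm_num)
  have hL : 0 < Real.log p := Real.log_pos hp
  rw [← Finset.sum_filter]
  set S := (Finset.range N).filter (2 ≤ ·)
  have hq {q : ℕ} (h : q ∈ S) : (2 : ℝ) ≤ q := by exact_mod_cast (Finset.mem_filter.1 h).2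
  have hlog {q : ℕ} (h : q ∈ S) : 0 < Real.log (p * q) :=
    Real.log_pos (by nlinarith [hq h])
  have hint {q : ℕ} (h : q ∈ S) : MeasureTheory.IntegrableOn (fun u ↦
      ArithmeticFunction.vonMangoldt q / q * (u * Real.exp (-(Real.log (p * q) * u))))
      (Set.Ioi 0) := (integrableOn_mul_exp_neg_mul (hlog h)).const_mul _
  have hb : -(Real.log p + Real.log 2 / 2) < 0 := by linarith
  calc _ = ∑ q ∈ S, ∫ u in Set.Ioi (0 : ℝ),
          ArithmeticFunction.vonMangoldt q / q * (u * Real.exp (-(Real.log (p * q) * u))) := by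
        refine Finset.sum_congr rfl fun q h ↦ ?_
        rw [MeasureTheory.integral_const_mul, integral_mul_exp_neg_mul (hlog h),
          div_mul_div_comm, mul_one]
    _ = ∫ u in Set.Ioi (0 : ℝ), ∑ q ∈ S,
          ArithmeticFunction.vonMangoldt q / q * (u * Real.exp (-(Real.log (p * q) * u))) :=
        (MeasureTheory.integral_finsetSum _ fun q h ↦ hint h).symm
    _ ≤ ∫ u in Set.Ioi (0 : ℝ), Real.exp (-(Real.log p + Real.log 2 / 2) * u) := by
        refine MeasureTheory.setIntegral_mono_on
          (MeasureTheory.integrable_finsetSum _ fun q h ↦ hint h)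
          (integrableOn_exp_mul_Ioi hb 0) measurableSet_Ioi fun u (hu : 0 < u) ↦ ?_
        have hterm : ∑ q ∈ S,
            ArithmeticFunction.vonMangoldt q / q * (u * Real.exp (-(Real.log (p * q) * u))) =
            Real.exp (-(Real.log p * u)) *
              (u * ∑ q ∈ S, ArithmeticFunction.vonMangoldt q / (q : ℝ) ^ (1 + u)) := by
          rw [Finset.mul_sum, Finset.mul_sum]
          refine Finset.sum_congr rfl fun q h ↦ ?_
          have hq0 : (0 : ℝ) < q := by linarith [hq h]
          rw [Real.log_mul (by linarith) hq0.ne', add_mul, neg_add, Real.exp_add,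
            Real.rpow_add hq0, Real.rpow_one, Real.rpow_def_of_pos hq0,
            Real.exp_neg (Real.log q * u)]
          field_simp
        rw [hterm, neg_mul, add_mul, neg_add, Real.exp_add]
        gcongr
        refine le_trans ?_ (mul_tsum_vonMangoldt_div_rpow_le hu)
        gcongr
        exact (summable_vonMangoldt_div_rpow (by linarith)).sum_le_tsum _ fun q _ ↦
          div_nonneg ArithmeticFunction.vonMangoldt_nonneg (by positivity)
    _ = _ := by
        rw [integral_exp_mul_Ioi hb]
        rw [mul_zero, Real.exp_zero, neg_div_neg_eq]

lemma tsum_one_div_sq_mul_pow_le {p : ℝ} (hp : 1 < p) :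
    ∑' k : ℕ, 1 / (((k : ℝ) + 2) ^ 2 * p ^ (k + 1)) ≤ 1 / (4 * (p - 1)) := by
  have hp0 : 0 < p := by linarith
  have hg := (hasSum_geometric_of_lt_one (by positivity) (inv_lt_one_of_one_lt₀ hp)).mul_left
    (1 / (4 * p))
  have hle (k : ℕ) : 1 / (((k : ℝ) + 2) ^ 2 * p ^ (k + 1)) ≤ 1 / (4 * p) * p⁻¹ ^ k := by
    rw [inv_pow, ← one_div, div_mul_div_comm, one_mul, mul_assoc, ← pow_succ']
    gcongr
    nlinarith [(k.cast_nonneg : (0 : ℝ) ≤ k)]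
  refine ((hg.summable.of_nonneg_of_le (fun k ↦ by positivity) hle).tsum_le_tsum hle
    hg.summable).trans_eq ?_
  rw [hg.tsum_eq]
  have : p - 1 ≠ 0 := by linarith
  field_simp

theorem subinvariance_at_prime (p : ℕ) (hp : p.Prime) :
    Real.log p * (∑' q : ℕ, if 2 ≤ q then
        ArithmeticFunction.vonMangoldt q / ((q : ℝ) * (Real.log ((p : ℝ) * q)) ^ 2) else 0) +
      (∑' k : ℕ, 1 / ((((k : ℝ) + 2)) ^ 2 * (p : ℝ) ^ (k + 1))) ≤ 1 := by
  have hp2 : (2 : ℝ) ≤ p := by exact_mod_cast hp.two_le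
  have hp1 : (1 : ℝ) < p := by linarith
  have hl2 : 0 < Real.log 2 := Real.log_pos (by norm_num)
  have hL : 0 < Real.log p := Real.log_pos hp1
  have h1 := Real.tsum_le_of_sum_range_le (fun q ↦ by
    split_ifs
    · exact div_nonneg ArithmeticFunction.vonMangoldt_nonneg (by positivity)
    · exact le_rfl) (sum_vonMangoldt_div_mul_sq_le hp1)
  have h2 := tsum_one_div_sq_mul_pow_le hp1
  have hlog : Real.log p ≤ (p - 1) * Real.log 2 := by
    have h : (p : ℝ) ≤ 2 ^ (p - 1) := by
      have := Nat.lt_two_pow_self (n := p - 1)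
      exact_mod_cast (by omega : p ≤ 2 ^ (p - 1))
    have h' := Real.log_le_log (by linarith) h
    rwa [Real.log_pow, Nat.cast_pred hp.pos] at h'
  have h3 : Real.log p * (1 / (Real.log p + Real.log 2 / 2)) + 1 / (4 * (p - 1)) ≤ 1 := by
    have hd : 0 < (p : ℝ) - 1 := by linarith
    rw [mul_one_div, div_add_div _ _ (by positivity) (by positivity), div_le_one (by positivity)]
    nlinarith
  linarith [mul_le_mul_of_nonneg_left h1 hL.le]
end

section
/- There is an absolute constant $C$ such that for every real $x \geq 2$, $\sum_{r \geq x} \frac{1}{r \log^2 r} \sum_{\substack{q \mid r \\ r/q < x}} \Lambda(q) \leq 1 + \frac{C}{\log x}$, where the outer sum is over natural numbers $r \geq x$ and the inner sum is over divisors $q$ of $r$ with $r/q < x$. -/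
open scoped Classical

open Finset ArithmeticFunction in
theorem sum_Icc_div_sq_le {a g : ℕ → ℝ} {K : ℝ} {m N : ℕ} (hmN : m ≤ N)
    (hpos : ∀ k, m ≤ k → 0 < g k) (hg : ∀ k, m ≤ k → g k ≤ g (k + 1))
    (hA : ∀ k, m ≤ k → ∑ i ∈ Icc m k, a i ≤ g k - g m + K) :
    ∑ k ∈ Icc m N, a k / g k ^ 2 ≤ 1 / g m + K / g m ^ 2 := by
  have key : ∑ k ∈ Icc m N, a k / g k ^ 2
      + (g N - g m + K - ∑ k ∈ Icc m N, a k) / g N ^ 2 ≤ 1 / g m - 1 / g N + K / g m ^ 2 := by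
    induction N, hmN using Nat.le_induction with
    | base => simp; apply le_of_eq; ring
    | succ N hN ih =>
      rw [sum_Icc_succ_top (by lia), sum_Icc_succ_top (by lia)]
      have h0 := hpos N hN
      have h1 := hpos (N + 1) (by lia)
      have hle := hg N hN
      have hD : 0 ≤ g N - g m + K - ∑ k ∈ Icc m N, a k := by linarith [hA N hN]
      set D := g N - g m + K - ∑ k ∈ Icc m N, a k
      have e1 : D / g (N + 1) ^ 2 ≤ D / g N ^ 2 := by gcongr
      have e2 : (g (N + 1) - g N) / g (N + 1) ^ 2 ≤ 1 / g N - 1 / g (N + 1) := by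
        rw [div_sub_div _ _ h0.ne' h1.ne', one_mul, mul_one, sq]
        have : 0 ≤ g (N + 1) - g N := by linarith
        gcongr
      have e3 : (g (N + 1) - g m + K - (∑ k ∈ Icc m N, a k + a (N + 1))) / g (N + 1) ^ 2
          = D / g (N + 1) ^ 2 + (g (N + 1) - g N) / g (N + 1) ^ 2
            - a (N + 1) / g (N + 1) ^ 2 := by
        simp only [D]; ring
      rw [e3]
      linarith
  have hD : 0 ≤ (g N - g m + K - ∑ k ∈ Icc m N, a k) / g N ^ 2 :=
    div_nonneg (by linarith [hA N hmN]) (sq_nonneg _)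
  have : 0 < 1 / g N := one_div_pos.2 (hpos N hmN)
  linarith

open Finset ArithmeticFunction in
theorem sum_vonMangoldt_mul_div_eq_log_factorial (N : ℕ) :
    ∑ d ∈ Ioc 0 N, vonMangoldt d * ((N / d : ℕ) : ℝ) = Real.log (N.factorial) := by
  rw [← sum_Ioc_mul_zeta_eq_sum, vonMangoldt_mul_zeta]
  induction N with
  | zero => simp
  | succ N ih =>
    rw [sum_Ioc_succ_top (Nat.zero_le N), ih, Nat.factorial_succ, Nat.cast_mul,
      Real.log_mul (by positivity) (by positivity), log_apply, add_comm]

open Finset ArithmeticFunction in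
theorem sum_vonMangoldt_div_le {N : ℕ} (hN : 1 ≤ N) :
    ∑ d ∈ Ioc 0 N, vonMangoldt d / d ≤ Real.log N + (Real.log 4 + 4) := by
  have hN0 : (0 : ℝ) < N := by exact_mod_cast hN
  have h1 : N * ∑ d ∈ Ioc 0 N, vonMangoldt d / d
      ≤ Real.log N.factorial + Chebyshev.psi N := by
    rw [← sum_vonMangoldt_mul_div_eq_log_factorial, Chebyshev.psi, Nat.floor_natCast,
      ← sum_add_distrib, mul_sum]
    refine sum_le_sum fun d _ ↦ ?_
    have : (N : ℝ) / d ≤ ((N / d : ℕ) : ℝ) + 1 := by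
      rw [← Nat.floor_div_eq_div (K := ℝ)]
      exact (Nat.lt_floor_add_one _).le
    calc (N : ℝ) * (vonMangoldt d / d) = vonMangoldt d * (N / d) := by ring
      _ ≤ vonMangoldt d * (((N / d : ℕ) : ℝ) + 1) := by gcongr
      _ = _ := by ring
  have h2 : Real.log N.factorial ≤ N * Real.log N := by
    rw [← Real.log_pow]
    exact Real.log_le_log (by positivity) (by exact_mod_cast Nat.factorial_le_pow N)
  have h3 := Chebyshev.psi_le_const_mul_self hN0.le
  refine le_of_mul_le_mul_left ?_ hN0
  linarith

open Finset ArithmeticFunction in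
theorem log_sub_one_le_sum_vonMangoldt_div {N : ℕ} (hN : 1 ≤ N) :
    Real.log N - 1 ≤ ∑ d ∈ Ioc 0 N, vonMangoldt d / d := by
  have hN0 : (0 : ℝ) < N := by exact_mod_cast hN
  have h1 : Real.log N.factorial ≤ N * ∑ d ∈ Ioc 0 N, vonMangoldt d / d := by
    rw [← sum_vonMangoldt_mul_div_eq_log_factorial, mul_sum]
    refine sum_le_sum fun d _ ↦ ?_
    calc vonMangoldt d * ((N / d : ℕ) : ℝ) ≤ vonMangoldt d * (N / d) := by
          gcongr; exact Nat.cast_div_le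
      _ = _ := by ring
  have h2 := Stirling.le_log_factorial_stirling (n := N) (by lia)
  have h3 : 0 ≤ Real.log N := Real.log_natCast_nonneg N
  have h4 : 0 ≤ Real.log (2 * Real.pi) := Real.log_nonneg (by linarith [Real.pi_gt_three])
  refine le_of_mul_le_mul_left ?_ hN0
  linarith

open Finset ArithmeticFunction in
theorem sum_Icc_vonMangoldt_div_le {m N : ℕ} (hm : 1 ≤ m) (hmN : m ≤ N) :
    ∑ d ∈ Icc m N, vonMangoldt d / d ≤ Real.log N - Real.log m + (Real.log 4 + 6) := by
  have hm0 : (0 : ℝ) < m := by exact_mod_cast hm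
  have h1 := sum_vonMangoldt_div_le (hm.trans hmN)
  have h2 := log_sub_one_le_sum_vonMangoldt_div hm
  have h3 : ∑ d ∈ Ioc 0 m, vonMangoldt d / d + ∑ d ∈ Ioc m N, vonMangoldt d / d
      = ∑ d ∈ Ioc 0 N, vonMangoldt d / (d : ℝ) :=
    sum_Ioc_consecutive _ (Nat.zero_le m) hmN
  have h4 : vonMangoldt m / m ≤ 1 := by
    rw [div_le_one hm0]
    exact vonMangoldt_le_log.trans ((Real.log_le_sub_one_of_pos hm0).trans (by linarith))
  rw [← add_sum_Ioc_eq_sum_Icc hmN]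
  linarith

open Finset ArithmeticFunction in
theorem sum_vonMangoldt_div_mul_log_sq_le {x : ℝ} (hx : 2 ≤ x) {n : ℕ} (hn : 1 ≤ n) (R : ℕ) :
    ∑ q ∈ Icc 1 R, (if x ≤ (n * q : ℕ) then
        vonMangoldt q / ((n * q : ℕ) * Real.log (n * q : ℕ) ^ 2) else 0)
      ≤ (n : ℝ)⁻¹ * (1 / Real.log x + (Real.log 4 + 6) / Real.log x ^ 2) := by
  have hn0 : (0 : ℝ) < n := by exact_mod_cast hn
  have hlx : 0 < Real.log x := Real.log_pos (by linarith)
  have hl4 : 0 ≤ Real.log 4 := Real.log_nonneg (by norm_num)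
  set m := ⌈x / n⌉₊ with hmdef
  have hiff (q : ℕ) : x ≤ (n * q : ℕ) ↔ m ≤ q := by
    rw [hmdef, Nat.ceil_le, div_le_iff₀ hn0, Nat.cast_mul, mul_comm]
  have hm : 1 ≤ m := Nat.one_le_ceil_iff.2 (by positivity)
  have hlog (q : ℕ) (hq : m ≤ q) : Real.log x ≤ Real.log (n * q : ℕ) :=
    Real.log_le_log (by linarith) ((hiff q).2 hq)
  rw [← sum_filter]
  have hS : (Icc 1 R).filter (fun q : ℕ ↦ x ≤ (n * q : ℕ)) = Icc m R := by
    ext q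
    simp only [mem_filter, mem_Icc, hiff]
    lia
  rw [hS]
  rcases lt_or_ge R m with h | h
  · rw [Icc_eq_empty (by lia), sum_empty]
    positivity
  have main := sum_Icc_div_sq_le (a := fun q ↦ vonMangoldt q / q)
    (g := fun q ↦ Real.log (n * q : ℕ)) (K := Real.log 4 + 6) h
    (fun k hk ↦ hlx.trans_le (hlog k hk))
    (fun k hk ↦ Real.log_le_log (by have := hm.trans hk; positivity) (by gcongr; lia))
    (fun k hk ↦ by
      have hm' : (m : ℝ) ≠ 0 := by positivity
      have hk' : (k : ℝ) ≠ 0 := by have := hm.trans hk; positivity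
      simp only [Nat.cast_mul]
      rw [Real.log_mul hn0.ne' hm', Real.log_mul hn0.ne' hk']
      linarith [sum_Icc_vonMangoldt_div_le hm hk])
  calc ∑ q ∈ Icc m R, vonMangoldt q / ((n * q : ℕ) * Real.log (n * q : ℕ) ^ 2)
      = (n : ℝ)⁻¹ * ∑ q ∈ Icc m R, vonMangoldt q / q / Real.log (n * q : ℕ) ^ 2 := by
        rw [mul_sum]
        refine sum_congr rfl fun q _ ↦ ?_
        rw [Nat.cast_mul, div_div, ← div_eq_inv_mul, div_div]
        ring
    _ ≤ (n : ℝ)⁻¹ * (1 / Real.log (n * m : ℕ)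
          + (Real.log 4 + 6) / Real.log (n * m : ℕ) ^ 2) := by gcongr
    _ ≤ _ := by
        have := hlog m le_rfl
        gcongr

open Finset ArithmeticFunction in
theorem boundary_term_le_sum_fiber {x : ℝ} {r R : ℕ} (hr : r < R) (hr0 : r ≠ 0)
    (hxr : x ≤ r) :
    (1 / ((r : ℝ) * (Real.log r) ^ 2)) *
        ∑ q ∈ r.divisors, (if ((r / q : ℕ) : ℝ) < x then vonMangoldt q else 0)
      ≤ ∑ p ∈ Icc 1 ⌊x⌋₊ ×ˢ Icc 1 R with p.1 * p.2 = r, (if x ≤ (p.1 * p.2 : ℕ) then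
        vonMangoldt p.2 / ((p.1 * p.2 : ℕ) * Real.log (p.1 * p.2 : ℕ) ^ 2) else 0) := by
  rw [← sum_filter, mul_sum]
  have hmul {q : ℕ} (hq : q ∈ r.divisors) : r / q * q = r :=
    Nat.div_mul_cancel (Nat.dvd_of_mem_divisors hq)
  calc _ = ∑ q ∈ r.divisors with ((r / q : ℕ) : ℝ) < x,
        (fun p : ℕ × ℕ ↦ if x ≤ (p.1 * p.2 : ℕ) then
          vonMangoldt p.2 / ((p.1 * p.2 : ℕ) * Real.log (p.1 * p.2 : ℕ) ^ 2) else 0)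
            (r / q, q) := by
        refine sum_congr rfl fun q hq ↦ ?_
        simp only [hmul (mem_filter.1 hq).1, if_pos hxr]
        ring
    _ = ∑ p ∈ (r.divisors.filter fun q ↦ ((r / q : ℕ) : ℝ) < x).image fun q ↦ (r / q, q),
        (if x ≤ (p.1 * p.2 : ℕ) then
          vonMangoldt p.2 / ((p.1 * p.2 : ℕ) * Real.log (p.1 * p.2 : ℕ) ^ 2) else 0) := by
        rw [sum_image fun a _ b _ h ↦ (Prod.mk.inj h).2]
    _ ≤ _ := by
        refine sum_le_sum_of_subset_of_nonneg ?_ fun p _ _ ↦ ?_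
        · intro p hp
          obtain ⟨q, hq, rfl⟩ := mem_image.1 hp
          obtain ⟨hq, hqx⟩ := mem_filter.1 hq
          have hqr := Nat.le_of_dvd (by lia) (Nat.dvd_of_mem_divisors hq)
          have hq0 := Nat.pos_of_mem_divisors hq
          simp only [mem_filter, mem_product, mem_Icc]
          exact ⟨⟨⟨Nat.div_pos hqr hq0, Nat.le_floor hqx.le⟩, hq0, by lia⟩, hmul hq⟩
        · split_ifs
          · exact div_nonneg vonMangoldt_nonneg (by positivity)
          · exact le_rfl

theorem vonMangoldt_boundary_sum_bound :
    ∃ C : ℝ, ∀ x : ℝ, 2 ≤ x →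
      (∑' r : ℕ, if x ≤ (r : ℝ) then
          (1 / ((r : ℝ) * (Real.log r) ^ 2)) *
            ∑ q ∈ r.divisors, (if ((r / q : ℕ) : ℝ) < x then
              ArithmeticFunction.vonMangoldt q else 0)
        else 0) ≤ 1 + C / Real.log x := by
  set K := Real.log 4 + 6 with hK
  have hK0 : 0 ≤ K := add_nonneg (Real.log_nonneg (by norm_num)) (by norm_num)
  refine ⟨1 + K + K / Real.log 2, fun x hx ↦ ?_⟩
  have hl2 : 0 < Real.log 2 := Real.log_pos (by norm_num)
  have hlx : Real.log 2 ≤ Real.log x := Real.log_le_log (by norm_num) hx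
  have hlx0 : 0 < Real.log x := hl2.trans_le hlx
  refine Real.tsum_le_of_sum_range_le (fun r ↦ ?_) fun R ↦ ?_
  · split_ifs
    · refine mul_nonneg (by positivity) (Finset.sum_nonneg fun q _ ↦ ?_)
      split_ifs
      · exact ArithmeticFunction.vonMangoldt_nonneg
      · exact le_rfl
    · exact le_rfl
  have hnonneg (p : ℕ × ℕ) : 0 ≤ (if x ≤ (p.1 * p.2 : ℕ) then
      ArithmeticFunction.vonMangoldt p.2 /
        ((p.1 * p.2 : ℕ) * Real.log (p.1 * p.2 : ℕ) ^ 2) else 0) := by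
    split_ifs
    · exact div_nonneg ArithmeticFunction.vonMangoldt_nonneg (by positivity)
    · exact le_rfl
  calc _ ≤ ∑ r ∈ Finset.range R, ∑ p ∈ Finset.Icc 1 ⌊x⌋₊ ×ˢ Finset.Icc 1 R with p.1 * p.2 = r,
        (if x ≤ (p.1 * p.2 : ℕ) then ArithmeticFunction.vonMangoldt p.2 /
          ((p.1 * p.2 : ℕ) * Real.log (p.1 * p.2 : ℕ) ^ 2) else 0) := by
        refine Finset.sum_le_sum fun r hr ↦ ?_
        split_ifs with h
        · refine boundary_term_le_sum_fiber (Finset.mem_range.1 hr) ?_ h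
          rintro rfl
          norm_num at h
          linarith
        · exact Finset.sum_nonneg fun p _ ↦ hnonneg p
    _ ≤ ∑ p ∈ Finset.Icc 1 ⌊x⌋₊ ×ˢ Finset.Icc 1 R,
        (if x ≤ (p.1 * p.2 : ℕ) then ArithmeticFunction.vonMangoldt p.2 /
          ((p.1 * p.2 : ℕ) * Real.log (p.1 * p.2 : ℕ) ^ 2) else 0) :=
        Finset.sum_fiberwise_le_sum_of_sum_fiber_nonneg
          fun r _ ↦ Finset.sum_nonneg fun p _ ↦ hnonneg p
    _ ≤ ∑ n ∈ Finset.Icc 1 ⌊x⌋₊, (n : ℝ)⁻¹ * (1 / Real.log x + K / Real.log x ^ 2) := by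
        rw [Finset.sum_product]
        exact Finset.sum_le_sum fun n hn ↦
          sum_vonMangoldt_div_mul_log_sq_le hx (Finset.mem_Icc.1 hn).1 R
    _ ≤ (1 + Real.log x) * (1 / Real.log x + K / Real.log x ^ 2) := by
        rw [← Finset.sum_mul]
        have := harmonic_floor_le_one_add_log x (by linarith)
        rw [harmonic_eq_sum_Icc] at this
        push_cast at this
        gcongr
    _ = 1 + (1 + K + K / Real.log x) / Real.log x := by
        field_simp
        ring
    _ ≤ 1 + (1 + K + K / Real.log 2) / Real.log x := by gcongr
end
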